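/- Let h₁, h₂ : [0,1] → ℝ be affine functions, h₁(u) = u(d₁ − c₁) + c₁ and h₂(u) = u(d₂ − c₂) + c₂ with c₁, d₁ > 0, c₂ ≥ 0, d₂ ≥ 0, such that h₂(u) > 0 for all u ∈ (0,1), and such that at any endpoint a ∈ {0,1} at which h₂(a) = 0 one has ln(h₁(a)/K) + R_d − R_f ≠ 0. Then for every third-order partial derivative ∂³Put_BS/∂x^{α₁}∂y^{α₂} with α₁ + α₂ = 3, the supremum sup_{u ∈ (0,1)} |∂³Put_BS/∂x^{α₁}∂y^{α₂} (h₁(u), h₂(u))| is finite. -/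

import Mathlib

open Real MeasureTheory Filter

/-- The standard normal cumulative distribution function Φ. -/
noncomputable def stdNormalCDF (x : ℝ) : ℝ :=
  ∫ t in Set.Iic x, (Real.sqrt (2 * Real.pi))⁻¹ * Real.exp (-t ^ 2 / 2)

/-- The standard normal density φ(z) = (2π)^{−1/2} e^{−z²/2}. -/
noncomputable def stdNormalPDF (z : ℝ) : ℝ :=
  (Real.sqrt (2 * Real.pi))⁻¹ * Real.exp (-z ^ 2 / 2)

/-- d₊(x,y) = (ln(x/K) + R_d − R_f)/√y + √y/2. -/
noncomputable def dplus (K Rd Rf x y : ℝ) : ℝ :=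
  (Real.log (x / K) + Rd - Rf) / Real.sqrt y + Real.sqrt y / 2

/-- d₋(x,y) = (ln(x/K) + R_d − R_f)/√y − √y/2. -/
noncomputable def dminus (K Rd Rf x y : ℝ) : ℝ :=
  (Real.log (x / K) + Rd - Rf) / Real.sqrt y - Real.sqrt y / 2

/-- The Black–Scholes put value Put_BS(x,y). -/
noncomputable def PutBS (K Rd Rf x y : ℝ) : ℝ :=
  K * Real.exp (-Rd) * stdNormalCDF (-(dminus K Rd Rf x y))
    - x * Real.exp (-Rf) * stdNormalCDF (-(dplus K Rd Rf x y))

/-- ∂₃Put_BS/∂x³. -/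
noncomputable def Pxxx (K Rd Rf x y : ℝ) : ℝ :=
  iteratedDeriv 3 (fun x' => PutBS K Rd Rf x' y) x

/-- ∂₃Put_BS/∂x²∂y. -/
noncomputable def Pxxy (K Rd Rf x y : ℝ) : ℝ :=
  deriv (fun y' => iteratedDeriv 2 (fun x' => PutBS K Rd Rf x' y') x) y

/-- ∂₃Put_BS/∂x∂y². -/
noncomputable def Pxyy (K Rd Rf x y : ℝ) : ℝ :=
  deriv (fun x' => iteratedDeriv 2 (fun y' => PutBS K Rd Rf x' y') y) x

/-- ∂₃Put_BS/∂y³. -/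
noncomputable def Pyyy (K Rd Rf x y : ℝ) : ℝ :=
  iteratedDeriv 3 (fun y' => PutBS K Rd Rf x y') y

/-- The logarithmic moneyness `ln (x / K) + R_d − R_f`. -/
noncomputable def logMoneyness (K Rd Rf x : ℝ) : ℝ := Real.log (x / K) + Rd - Rf

/-- `K e^{−R_d} φ(d₋) / √y`, which is `x² ∂²Put_BS/∂x²` and `2 ∂Put_BS/∂y`. -/
noncomputable def scaledGamma (K Rd Rf x y : ℝ) : ℝ :=
  K * Real.exp (-Rd) * stdNormalPDF (dminus K Rd Rf x y) / Real.sqrt y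

lemma stdNormalPDF_neg (z : ℝ) : stdNormalPDF (-z) = stdNormalPDF z := by
  simp [stdNormalPDF]

lemma continuous_stdNormalPDF : Continuous stdNormalPDF := by
  unfold stdNormalPDF
  fun_prop

lemma integrable_stdNormalPDF : Integrable stdNormalPDF := by
  have h := (integrable_exp_neg_mul_sq (b := 1 / 2) (by norm_num)).const_mul
    (Real.sqrt (2 * Real.pi))⁻¹
  refine h.congr (Eventually.of_forall fun t => ?_)
  simp only [stdNormalPDF]
  congr 2
  ring

lemma hasDerivAt_stdNormalCDF (z : ℝ) : HasDerivAt stdNormalCDF (stdNormalPDF z) z := by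
  have h : stdNormalCDF = fun z => (∫ t in (0 : ℝ)..z, stdNormalPDF t) + stdNormalCDF 0 := by
    funext z
    have := intervalIntegral.integral_Iic_sub_Iic (a := 0) (b := z)
      integrable_stdNormalPDF.integrableOn integrable_stdNormalPDF.integrableOn
    rw [← this]
    exact (sub_add_cancel _ _).symm
  rw [h]
  exact (continuous_stdNormalPDF.integral_hasStrictDerivAt 0 z).hasDerivAt.add_const _

lemma hasDerivAt_stdNormalPDF (z : ℝ) : HasDerivAt stdNormalPDF (-z * stdNormalPDF z) z := by
  have h := ((((hasDerivAt_id z).pow 2).neg.div_const 2).exp).const_mul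
    (Real.sqrt (2 * Real.pi))⁻¹
  refine h.congr_deriv ?_
  simp only [stdNormalPDF, id, Pi.neg_apply, Pi.pow_apply]
  push_cast
  ring

section Derivatives

variable {K Rd Rf x y : ℝ}

lemma hasDerivAt_logMoneyness (hK : 0 < K) (hx : 0 < x) :
    HasDerivAt (logMoneyness K Rd Rf) (1 / x) x := by
  have h := ((((hasDerivAt_id x).div_const K).log (by simp; constructor <;> positivity)).add_const
    Rd).sub_const Rf
  refine h.congr_deriv ?_
  simp only [id]
  field_simp

lemma hasDerivAt_dplus_fst (hK : 0 < K) (hx : 0 < x) :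
    HasDerivAt (fun x' => dplus K Rd Rf x' y) (1 / x / Real.sqrt y) x :=
  ((hasDerivAt_logMoneyness (Rd := Rd) (Rf := Rf) hK hx).div_const _).add_const _

lemma hasDerivAt_dminus_fst (hK : 0 < K) (hx : 0 < x) :
    HasDerivAt (fun x' => dminus K Rd Rf x' y) (1 / x / Real.sqrt y) x :=
  ((hasDerivAt_logMoneyness (Rd := Rd) (Rf := Rf) hK hx).div_const _).sub_const _

lemma hasDerivAt_dplus_snd (hy : 0 < y) :
    HasDerivAt (fun y' => dplus K Rd Rf x y') (-dminus K Rd Rf x y / (2 * y)) y := by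
  have hs := Real.hasDerivAt_sqrt hy.ne'
  have hs0 : 0 < Real.sqrt y := Real.sqrt_pos.2 hy
  refine (((hasDerivAt_const y (Real.log (x / K) + Rd - Rf)).div hs hs0.ne').add
    (hs.div_const 2)).congr_deriv ?_
  obtain ⟨s, hsy, hyy⟩ : ∃ s, s = Real.sqrt y ∧ y = s ^ 2 := ⟨_, rfl, (Real.sq_sqrt hy.le).symm⟩
  rw [dminus, ← hsy, hyy]
  rw [← hsy] at hs0
  field_simp
  ring

lemma hasDerivAt_dminus_snd (hy : 0 < y) :
    HasDerivAt (fun y' => dminus K Rd Rf x y') (-dplus K Rd Rf x y / (2 * y)) y := by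
  have hs := Real.hasDerivAt_sqrt hy.ne'
  have hs0 : 0 < Real.sqrt y := Real.sqrt_pos.2 hy
  refine (((hasDerivAt_const y (Real.log (x / K) + Rd - Rf)).div hs hs0.ne').sub
    (hs.div_const 2)).congr_deriv ?_
  obtain ⟨s, hsy, hyy⟩ : ∃ s, s = Real.sqrt y ∧ y = s ^ 2 := ⟨_, rfl, (Real.sq_sqrt hy.le).symm⟩
  rw [dplus, ← hsy, hyy]
  rw [← hsy] at hs0
  field_simp
  ring

lemma dplus_sq_sub_dminus_sq (hy : 0 < y) :
    dplus K Rd Rf x y ^ 2 - dminus K Rd Rf x y ^ 2 = 2 * logMoneyness K Rd Rf x := by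
  have hs0 : 0 < Real.sqrt y := Real.sqrt_pos.2 hy
  simp only [dplus, dminus, logMoneyness]
  field_simp
  ring

lemma spot_mul_stdNormalPDF_dplus (hK : 0 < K) (hx : 0 < x) (hy : 0 < y) :
    x * Real.exp (-Rf) * stdNormalPDF (dplus K Rd Rf x y)
      = K * Real.exp (-Rd) * stdNormalPDF (dminus K Rd Rf x y) := by
  have hxK : x = K * Real.exp (Real.log (x / K)) := by
    rw [Real.exp_log (by positivity)]
    field_simp
  have hd := dplus_sq_sub_dminus_sq (K := K) (Rd := Rd) (Rf := Rf) (x := x) hy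
  have he : Real.exp (Real.log (x / K)) * Real.exp (-Rf)
        * Real.exp (-dplus K Rd Rf x y ^ 2 / 2)
      = Real.exp (-Rd) * Real.exp (-dminus K Rd Rf x y ^ 2 / 2) := by
    rw [← Real.exp_add, ← Real.exp_add, ← Real.exp_add]
    congr 1
    rw [logMoneyness] at hd
    linarith
  simp only [stdNormalPDF]
  linear_combination (Real.exp (-Rf) * (Real.sqrt (2 * Real.pi))⁻¹ *
    Real.exp (-dplus K Rd Rf x y ^ 2 / 2)) * hxK + K * (Real.sqrt (2 * Real.pi))⁻¹ * he

lemma hasDerivAt_putBS_fst (hK : 0 < K) (hx : 0 < x) (hy : 0 < y) :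
    HasDerivAt (fun x' => PutBS K Rd Rf x' y)
      (-Real.exp (-Rf) * stdNormalCDF (-dplus K Rd Rf x y)) x := by
  have hm := (hasDerivAt_stdNormalCDF _).comp x
    (hasDerivAt_dminus_fst (Rd := Rd) (Rf := Rf) (y := y) hK hx).neg
  have hp := (hasDerivAt_stdNormalCDF _).comp x
    (hasDerivAt_dplus_fst (Rd := Rd) (Rf := Rf) (y := y) hK hx).neg
  refine ((hm.const_mul (K * Real.exp (-Rd))).sub
    (((hasDerivAt_id x).mul_const (Real.exp (-Rf))).mul hp)).congr_deriv ?_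
  have h := spot_mul_stdNormalPDF_dplus (Rd := Rd) (Rf := Rf) hK hx hy
  simp only [Pi.neg_apply, Function.comp_apply, stdNormalPDF_neg, id]
  linear_combination (1 / x / Real.sqrt y) * h

lemma hasDerivAt_delta_fst (hK : 0 < K) (hx : 0 < x) (hy : 0 < y) :
    HasDerivAt (fun x' => -Real.exp (-Rf) * stdNormalCDF (-dplus K Rd Rf x' y))
      (scaledGamma K Rd Rf x y / x ^ 2) x := by
  have hp := (hasDerivAt_stdNormalCDF _).comp x
    (hasDerivAt_dplus_fst (Rd := Rd) (Rf := Rf) (y := y) hK hx).neg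
  refine (hp.const_mul (-Real.exp (-Rf))).congr_deriv ?_
  have hs0 : 0 < Real.sqrt y := Real.sqrt_pos.2 hy
  rw [scaledGamma, ← spot_mul_stdNormalPDF_dplus hK hx hy]
  simp only [Pi.neg_apply, stdNormalPDF_neg]
  field_simp

lemma hasDerivAt_putBS_snd (hK : 0 < K) (hx : 0 < x) (hy : 0 < y) :
    HasDerivAt (fun y' => PutBS K Rd Rf x y') (scaledGamma K Rd Rf x y / 2) y := by
  have hm := (hasDerivAt_stdNormalCDF _).comp y
    (hasDerivAt_dminus_snd (K := K) (Rd := Rd) (Rf := Rf) (x := x) hy).neg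
  have hp := (hasDerivAt_stdNormalCDF _).comp y
    (hasDerivAt_dplus_snd (K := K) (Rd := Rd) (Rf := Rf) (x := x) hy).neg
  refine ((hm.const_mul (K * Real.exp (-Rd))).sub
    (hp.const_mul (x * Real.exp (-Rf)))).congr_deriv ?_
  have h := spot_mul_stdNormalPDF_dplus (Rd := Rd) (Rf := Rf) hK hx hy
  have hs0 : 0 < Real.sqrt y := Real.sqrt_pos.2 hy
  have hd : dplus K Rd Rf x y - dminus K Rd Rf x y = Real.sqrt y := by
    simp only [dplus, dminus]
    ring
  have hyy : Real.sqrt y / (2 * y) = 1 / (2 * Real.sqrt y) := by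
    rw [div_eq_div_iff (by positivity) (by positivity)]
    linear_combination 2 * Real.mul_self_sqrt hy.le
  simp only [Pi.neg_apply, stdNormalPDF_neg, scaledGamma]
  linear_combination (-dminus K Rd Rf x y / (2 * y)) * h
    + K * Real.exp (-Rd) * stdNormalPDF (dminus K Rd Rf x y) * (hd / (2 * y) + hyy)

lemma hasDerivAt_scaledGamma_fst (hK : 0 < K) (hx : 0 < x) (hy : 0 < y) :
    HasDerivAt (fun x' => scaledGamma K Rd Rf x' y)
      (scaledGamma K Rd Rf x y * ((1 / 2 - logMoneyness K Rd Rf x / y) / x)) x := by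
  have hm := (hasDerivAt_stdNormalPDF _).comp x
    (hasDerivAt_dminus_fst (Rd := Rd) (Rf := Rf) (y := y) hK hx)
  refine ((hm.const_mul (K * Real.exp (-Rd))).div_const (Real.sqrt y)).congr_deriv ?_
  have hs0 : 0 < Real.sqrt y := Real.sqrt_pos.2 hy
  have hd : dminus K Rd Rf x y / Real.sqrt y = logMoneyness K Rd Rf x / y - 1 / 2 := by
    rw [dminus, ← logMoneyness, sub_div, div_div, Real.mul_self_sqrt hy.le]
    field_simp
  simp only [scaledGamma]
  linear_combination (-(K * Real.exp (-Rd) * stdNormalPDF (dminus K Rd Rf x y) / Real.sqrt y / x))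
    * hd

lemma hasDerivAt_scaledGamma_snd (hy : 0 < y) :
    HasDerivAt (fun y' => scaledGamma K Rd Rf x y')
      (scaledGamma K Rd Rf x y *
        (logMoneyness K Rd Rf x ^ 2 / (2 * y ^ 2) - 1 / 8 - 1 / (2 * y))) y := by
  have hm := (hasDerivAt_stdNormalPDF _).comp y
    (hasDerivAt_dminus_snd (K := K) (Rd := Rd) (Rf := Rf) (x := x) hy)
  have hs := Real.hasDerivAt_sqrt hy.ne'
  have hs0 : 0 < Real.sqrt y := Real.sqrt_pos.2 hy
  refine ((hm.const_mul (K * Real.exp (-Rd))).div hs hs0.ne').congr_deriv ?_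
  simp only [scaledGamma, Function.comp_apply]
  generalize stdNormalPDF (dminus K Rd Rf x y) = p
  obtain ⟨s, hsy, hyy⟩ : ∃ s, s = Real.sqrt y ∧ y = s ^ 2 := ⟨_, rfl, (Real.sq_sqrt hy.le).symm⟩
  simp only [dminus, dplus, logMoneyness]
  rw [← hsy] at hs0 ⊢
  rw [hyy]
  field_simp
  ring

lemma deriv_eq_of_forall_pos {f g : ℝ → ℝ} (h : ∀ t, 0 < t → f t = g t) {t : ℝ} (ht : 0 < t) :
    deriv f t = deriv g t :=
  EventuallyEq.deriv_eq ((eventually_gt_nhds ht).mono h)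

lemma iteratedDeriv_two_eq_of_hasDerivAt_pos {f f₁ f₂ : ℝ → ℝ}
    (h₁ : ∀ t, 0 < t → HasDerivAt f (f₁ t) t) (h₂ : ∀ t, 0 < t → HasDerivAt f₁ (f₂ t) t)
    {t : ℝ} (ht : 0 < t) : iteratedDeriv 2 f t = f₂ t := by
  rw [iteratedDeriv_succ, iteratedDeriv_one,
    deriv_eq_of_forall_pos (fun t ht => (h₁ t ht).deriv) ht, (h₂ t ht).deriv]

lemma iteratedDeriv_three_eq_of_hasDerivAt_pos {f f₁ f₂ f₃ : ℝ → ℝ}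
    (h₁ : ∀ t, 0 < t → HasDerivAt f (f₁ t) t) (h₂ : ∀ t, 0 < t → HasDerivAt f₁ (f₂ t) t)
    (h₃ : ∀ t, 0 < t → HasDerivAt f₂ (f₃ t) t)
    {t : ℝ} (ht : 0 < t) : iteratedDeriv 3 f t = f₃ t := by
  rw [iteratedDeriv_succ,
    deriv_eq_of_forall_pos (fun t ht => iteratedDeriv_two_eq_of_hasDerivAt_pos h₁ h₂ ht) ht,
    (h₃ t ht).deriv]

lemma Pxxx_eq (hK : 0 < K) (hx : 0 < x) (hy : 0 < y) :
    Pxxx K Rd Rf x y = scaledGamma K Rd Rf x y / y ^ 4 *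
      ((-(3 / 2) * y ^ 4 - logMoneyness K Rd Rf x * y ^ 3) / x ^ 3) := by
  refine (iteratedDeriv_three_eq_of_hasDerivAt_pos (fun t ht => hasDerivAt_putBS_fst hK ht hy)
    (fun t ht => hasDerivAt_delta_fst hK ht hy)
    (fun t ht => (hasDerivAt_scaledGamma_fst hK ht hy).div ((hasDerivAt_id t).pow 2)
      (by simp [ht.ne'])) hx).trans ?_
  simp only [id]
  push_cast
  field_simp
  ring

lemma Pxxy_eq (hK : 0 < K) (hx : 0 < x) (hy : 0 < y) :
    Pxxy K Rd Rf x y = scaledGamma K Rd Rf x y / y ^ 4 *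
      ((logMoneyness K Rd Rf x ^ 2 * y ^ 2 / 2 - y ^ 4 / 8 - y ^ 3 / 2) / x ^ 2) := by
  rw [Pxxy, deriv_eq_of_forall_pos (fun t ht => iteratedDeriv_two_eq_of_hasDerivAt_pos
    (fun x' hx' => hasDerivAt_putBS_fst hK hx' ht)
    (fun x' hx' => hasDerivAt_delta_fst hK hx' ht) hx) hy,
    ((hasDerivAt_scaledGamma_snd hy).div_const _).deriv]
  field_simp

lemma Pxyy_eq (hK : 0 < K) (hx : 0 < x) (hy : 0 < y) :
    Pxyy K Rd Rf x y = scaledGamma K Rd Rf x y / y ^ 4 *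
      (((y / 2 - logMoneyness K Rd Rf x) *
        (logMoneyness K Rd Rf x ^ 2 * y / 2 - y ^ 3 / 8 - y ^ 2 / 2)
        + logMoneyness K Rd Rf x * y ^ 2) / (2 * x)) := by
  have hL := hasDerivAt_logMoneyness (Rd := Rd) (Rf := Rf) hK hx
  rw [Pxyy, deriv_eq_of_forall_pos (fun t ht => iteratedDeriv_two_eq_of_hasDerivAt_pos
    (fun y' hy' => hasDerivAt_putBS_snd hK ht hy')
    (fun y' hy' => (hasDerivAt_scaledGamma_snd hy').div_const 2) hy) hx]
  refine (((hasDerivAt_scaledGamma_fst hK hx hy).mul ((((hL.pow 2).div_const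
    (2 * y ^ 2)).sub_const (1 / 8)).sub_const (1 / (2 * y)))).div_const 2).deriv.trans ?_
  simp only [Pi.pow_apply]
  push_cast
  field_simp

lemma Pyyy_eq (hK : 0 < K) (hx : 0 < x) (hy : 0 < y) :
    Pyyy K Rd Rf x y = scaledGamma K Rd Rf x y / y ^ 4 *
      (((logMoneyness K Rd Rf x ^ 2 / 2 - y ^ 2 / 8 - y / 2) ^ 2
        - logMoneyness K Rd Rf x ^ 2 * y + y ^ 2 / 2) / 2) := by
  have hrat : ∀ t : ℝ, 0 < t → HasDerivAt
      (fun t => logMoneyness K Rd Rf x ^ 2 / (2 * t ^ 2) - 1 / 8 - 1 / (2 * t))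
      (-logMoneyness K Rd Rf x ^ 2 / t ^ 3 + 1 / (2 * t ^ 2)) t := fun t ht => by
    refine ((((hasDerivAt_const t (logMoneyness K Rd Rf x ^ 2)).div
      (((hasDerivAt_id t).pow 2).const_mul 2) (by simp [ht.ne'])).sub_const (1 / 8)).sub
      ((hasDerivAt_const t (1 : ℝ)).div ((hasDerivAt_id t).const_mul 2)
        (by simp [ht.ne']))).congr_deriv ?_
    simp only [id, Pi.pow_apply]
    push_cast
    field_simp
    ring
  refine (iteratedDeriv_three_eq_of_hasDerivAt_pos (fun t ht => hasDerivAt_putBS_snd hK hx ht)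
    (fun t ht => (hasDerivAt_scaledGamma_snd ht).div_const 2)
    (fun t ht => ((hasDerivAt_scaledGamma_snd ht).mul (hrat t ht)).div_const 2) hy).trans ?_
  field_simp
  ring

lemma scaledGamma_div_pow_four (hy : 0 < y) :
    scaledGamma K Rd Rf x y / y ^ 4
      = Real.exp (-(logMoneyness K Rd Rf x ^ 2 / (2 * y))) / y ^ 5 *
        (K * Real.exp (-Rd) * (Real.sqrt (2 * Real.pi))⁻¹ *
          Real.exp (logMoneyness K Rd Rf x / 2 - y / 8) * Real.sqrt y) := by
  have hs0 : 0 < Real.sqrt y := Real.sqrt_pos.2 hy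
  have hd : -dminus K Rd Rf x y ^ 2 / 2
      = -(logMoneyness K Rd Rf x ^ 2 / (2 * y)) + (logMoneyness K Rd Rf x / 2 - y / 8) := by
    have hyy : y = Real.sqrt y ^ 2 := (Real.sq_sqrt hy.le).symm
    rw [dminus, ← logMoneyness]
    generalize Real.sqrt y = s at *
    rw [hyy]
    field_simp
    ring
  rw [scaledGamma, stdNormalPDF, hd, Real.exp_add]
  have hyy : 1 / Real.sqrt y = Real.sqrt y / y := by
    rw [div_eq_div_iff hs0.ne' hy.ne', one_mul, Real.mul_self_sqrt hy.le]
  rw [div_eq_mul_one_div _ (Real.sqrt y), hyy]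
  field_simp

end Derivatives

lemma exp_neg_div_pow_five_le {m l y : ℝ} (hm : 0 < m) (hy : 0 < y) (h : m ≤ y + l ^ 2) :
    Real.exp (-(l ^ 2 / (2 * y))) / y ^ 5 ≤ 120 * (4 / m) ^ 5 := by
  rcases le_total (m / 2) y with hmy | hmy
  · have h1 : Real.exp (-(l ^ 2 / (2 * y))) ≤ 1 := Real.exp_le_one_iff.2 (by
      have : 0 ≤ l ^ 2 / (2 * y) := by positivity
      linarith)
    calc Real.exp (-(l ^ 2 / (2 * y))) / y ^ 5 ≤ 1 / (m / 2) ^ 5 := by gcongr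
      _ = 32 * (1 / m) ^ 5 := by field_simp; norm_num
      _ ≤ 120 * (4 / m) ^ 5 := by gcongr <;> norm_num
  · have ht : m / (4 * y) ≤ l ^ 2 / (2 * y) := by
      rw [div_le_div_iff₀ (by positivity) (by positivity)]
      nlinarith
    have hpow := Real.pow_div_factorial_le_exp (m / (4 * y)) (by positivity) 5
    have hpos : 0 < (m / (4 * y)) ^ 5 / (Nat.factorial 5 : ℝ) := by positivity
    calc Real.exp (-(l ^ 2 / (2 * y))) / y ^ 5
        ≤ ((m / (4 * y)) ^ 5 / (Nat.factorial 5 : ℝ))⁻¹ / y ^ 5 := by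
          rw [Real.exp_neg]
          gcongr
          exact hpow.trans (Real.exp_le_exp.2 ht)
      _ = 120 * (4 / m) ^ 5 := by
          norm_num [Nat.factorial]
          field_simp

lemma exists_bound_scaledGamma_mul {K Rd Rf : ℝ} {h1 h2 F : ℝ → ℝ}
    (hL : ContinuousOn (fun u => logMoneyness K Rd Rf (h1 u)) (Set.Icc 0 1))
    (hc2 : ContinuousOn h2 (Set.Icc 0 1)) (hpos : ∀ u ∈ Set.Ioo (0 : ℝ) 1, 0 < h2 u)
    (hsum : ∀ u ∈ Set.Icc (0 : ℝ) 1, 0 < h2 u + logMoneyness K Rd Rf (h1 u) ^ 2)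
    (hF : ContinuousOn F (Set.Icc 0 1)) :
    ∃ M : ℝ, ∀ u ∈ Set.Ioo (0 : ℝ) 1,
      |scaledGamma K Rd Rf (h1 u) (h2 u) / h2 u ^ 4 * F u| ≤ M := by
  obtain ⟨u₀, hu₀, hmin⟩ := isCompact_Icc.exists_isMinOn
    (Set.nonempty_Icc.2 (zero_le_one (α := ℝ))) (hc2.add (hL.pow 2))
  have hG : ContinuousOn (fun u => K * Real.exp (-Rd) * (Real.sqrt (2 * Real.pi))⁻¹ *
      Real.exp (logMoneyness K Rd Rf (h1 u) / 2 - h2 u / 8) * Real.sqrt (h2 u) * F u)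
      (Set.Icc 0 1) := by fun_prop
  obtain ⟨C, hC⟩ := isCompact_Icc.exists_bound_of_continuousOn hG
  refine ⟨120 * (4 / (h2 u₀ + logMoneyness K Rd Rf (h1 u₀) ^ 2)) ^ 5 * C, fun u hu => ?_⟩
  have hu' := Set.Ioo_subset_Icc_self hu
  have hE := exp_neg_div_pow_five_le (hsum u₀ hu₀) (hpos u hu) (hmin hu')
  have hy := hpos u hu
  rw [scaledGamma_div_pow_four hy, mul_assoc, abs_mul, abs_of_pos (by positivity)]
  exact mul_le_mul hE (hC u hu') (abs_nonneg _)
    ((by positivity : (0 : ℝ) ≤ _).trans hE)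

/-- Along an affine path (h₁(u), h₂(u)), u ∈ (0,1), with h₁ positive at the endpoints, h₂
positive on (0,1), and with f̂(h₁(a)) = ln(h₁(a)/K) + R_d − R_f ≠ 0 at any endpoint a
where h₂(a) = 0, each third-order partial derivative of Put_BS is bounded. -/
theorem putBS_third_partials_bounded_along_path (K Rd Rf : ℝ) (hK : 0 < K)
    (c1 d1 c2 d2 : ℝ) (hc1 : 0 < c1) (hd1 : 0 < d1) (hc2 : 0 ≤ c2) (hd2 : 0 ≤ d2)
    (h1 h2 : ℝ → ℝ)
    (hh1 : ∀ u, h1 u = u * (d1 - c1) + c1)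
    (hh2 : ∀ u, h2 u = u * (d2 - c2) + c2)
    (hpos : ∀ u ∈ Set.Ioo (0 : ℝ) 1, 0 < h2 u)
    (hend : ∀ a ∈ ({0, 1} : Set ℝ), h2 a = 0 → Real.log (h1 a / K) + Rd - Rf ≠ 0) :
    (∃ M : ℝ, ∀ u ∈ Set.Ioo (0 : ℝ) 1, |Pxxx K Rd Rf (h1 u) (h2 u)| ≤ M) ∧
    (∃ M : ℝ, ∀ u ∈ Set.Ioo (0 : ℝ) 1, |Pxxy K Rd Rf (h1 u) (h2 u)| ≤ M) ∧
    (∃ M : ℝ, ∀ u ∈ Set.Ioo (0 : ℝ) 1, |Pxyy K Rd Rf (h1 u) (h2 u)| ≤ M) ∧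
    (∃ M : ℝ, ∀ u ∈ Set.Ioo (0 : ℝ) 1, |Pyyy K Rd Rf (h1 u) (h2 u)| ≤ M) := by
  have hx : ∀ u ∈ Set.Icc (0 : ℝ) 1, 0 < h1 u := fun u hu => by
    rw [hh1]
    rcases hu.1.eq_or_lt with rfl | h0
    · simpa using hc1
    · nlinarith [mul_pos h0 hd1, mul_nonneg (sub_nonneg.2 hu.2) hc1.le]
  have hcont1 : ContinuousOn h1 (Set.Icc 0 1) := by
    rw [funext hh1]
    fun_prop
  have hcont2 : ContinuousOn h2 (Set.Icc 0 1) := by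
    rw [funext hh2]
    fun_prop
  have hL : ContinuousOn (fun u => logMoneyness K Rd Rf (h1 u)) (Set.Icc 0 1) := fun u hu =>
    (hasDerivAt_logMoneyness hK (hx u hu)).continuousAt.comp_continuousWithinAt (hcont1 u hu)
  have hsum : ∀ u ∈ Set.Icc (0 : ℝ) 1, 0 < h2 u + logMoneyness K Rd Rf (h1 u) ^ 2 := by
    have hend' : ∀ a ∈ ({0, 1} : Set ℝ), 0 ≤ h2 a →
        0 < h2 a + logMoneyness K Rd Rf (h1 a) ^ 2 := fun a ha h0 => by
      rcases h0.eq_or_lt with h | h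
      · have := pow_pos (abs_pos.2 (hend a ha h.symm)) 2
        rw [sq_abs] at this
        exact add_pos_of_nonneg_of_pos h0 this
      · positivity
    intro u hu
    rcases hu.1.eq_or_lt with rfl | hu0
    · exact hend' 0 (by simp) (by simpa [hh2] using hc2)
    rcases hu.2.eq_or_lt with rfl | hu1
    · exact hend' 1 (by simp) (by simpa [hh2] using hd2)
    · have := hpos u ⟨hu0, hu1⟩
      positivity
  have hx3 : ∀ u ∈ Set.Icc (0 : ℝ) 1, h1 u ^ 3 ≠ 0 := fun u hu => pow_ne_zero _ (hx u hu).ne'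
  have hx2 : ∀ u ∈ Set.Icc (0 : ℝ) 1, h1 u ^ 2 ≠ 0 := fun u hu => pow_ne_zero _ (hx u hu).ne'
  have hx1 : ∀ u ∈ Set.Icc (0 : ℝ) 1, 2 * h1 u ≠ 0 := fun u hu =>
    mul_ne_zero two_ne_zero (hx u hu).ne'
  have bounded : ∀ {P : ℝ → ℝ → ℝ} {F : ℝ → ℝ}, ContinuousOn F (Set.Icc 0 1) →
      (∀ u, 0 < h1 u → 0 < h2 u →
        P (h1 u) (h2 u) = scaledGamma K Rd Rf (h1 u) (h2 u) / h2 u ^ 4 * F u) →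
      ∃ M : ℝ, ∀ u ∈ Set.Ioo (0 : ℝ) 1, |P (h1 u) (h2 u)| ≤ M := fun hF hP => by
    obtain ⟨M, hM⟩ := exists_bound_scaledGamma_mul hL hcont2 hpos hsum hF
    refine ⟨M, fun u hu => ?_⟩
    rw [hP u (hx u (Set.Ioo_subset_Icc_self hu)) (hpos u hu)]
    exact hM u hu
  refine ⟨bounded ?_ fun u => Pxxx_eq hK, bounded ?_ fun u => Pxxy_eq hK,
    bounded ?_ fun u => Pxyy_eq hK, bounded ?_ fun u => Pyyy_eq hK⟩
  · exact ContinuousOn.div (by fun_prop) (by fun_prop) hx3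
  · exact ContinuousOn.div (by fun_prop) (by fun_prop) hx2
  · exact ContinuousOn.div (by fun_prop) (by fun_prop) hx1
  · fun_prop
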